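/- arXiv:1203.2813 — 3 statements merged into one kernel-verified Lean document; each statement's English description precedes it below -/
import Mathlib

section
/- Let K be an infinite compact subset of ℝ^d. Then the set of measures μ ∈ P(K) satisfying D̲_μ(−∞) = dim̲_B(K) (the lower box dimension of K) and D̄_μ(−∞) = +∞ is residual in P(K) (it contains a dense G_δ set). -/
open MeasureTheory Filter Metric Set Topology

noncomputable section

/-- `ℝ^d` with the Euclidean metric. -/
abbrev Euc (d : ℕ) : Type := EuclideanSpace ℝ (Fin d)

/-- The largest number of pairwise disjoint balls of radius `r` with centers in `E`. -/
noncomputable def packingNumber {X : Type*} [MetricSpace X] (E : Set X) (r : ℝ) : ℕ :=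
  sSup {n : ℕ | ∃ c : Fin n → X, (∀ i, c i ∈ E) ∧
    Pairwise fun i j => Disjoint (ball (c i) r) (ball (c j) r)}

/-- The smallest number of balls of radius `r` needed to cover `E`. -/
noncomputable def coveringNumber {X : Type*} [MetricSpace X] (E : Set X) (r : ℝ) : ℕ :=
  sInf {n : ℕ | ∃ c : Fin n → X, E ⊆ ⋃ i, ball (c i) r}

/-- Upper box (Minkowski) dimension. -/
noncomputable def upperBoxDim {X : Type*} [MetricSpace X] (E : Set X) : EReal :=
  limsup (fun r : ℝ => ((Real.log (coveringNumber E r : ℝ) / (-Real.log r) : ℝ) : EReal))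
    (𝓝[>] (0:ℝ))

/-- Lower box (Minkowski) dimension. -/
noncomputable def lowerBoxDim {X : Type*} [MetricSpace X] (E : Set X) : EReal :=
  liminf (fun r : ℝ => ((Real.log (coveringNumber E r : ℝ) / (-Real.log r) : ℝ) : EReal))
    (𝓝[>] (0:ℝ))

/-- Packing dimension, defined as the modified upper box dimension. -/
noncomputable def packingDim {X : Type*} [MetricSpace X] (E : Set X) : EReal :=
  ⨅ (F : ℕ → Set X) (_ : E ⊆ ⋃ n, F n), ⨆ n, upperBoxDim (F n)

/-- The local uniform upper box dimension. -/
noncomputable def locUnifUpperBoxDim {X : Type*} [MetricSpace X] (K : Set X) : EReal :=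
  ⨅ (N : ℕ) (_ : 1 ≤ N) (x : Fin N → X) (_ : ∀ i, x i ∈ K) (r₀ : ℝ) (_ : 0 < r₀),
    limsup (fun r : ℝ =>
      ((⨅ i : Fin N, Real.log (packingNumber (K ∩ ball (x i) r₀) r : ℝ) / (-Real.log r) : ℝ)
        : EReal)) (𝓝[>] (0:ℝ))

/-- The convex upper box dimension. -/
noncomputable def convUpperBoxDim {X : Type*} [MetricSpace X] (K : Set X) : EReal :=
  ⨅ (N : ℕ) (_ : 1 ≤ N) (x : Fin N → X) (_ : ∀ i, x i ∈ K) (ρ : ℝ) (_ : 0 < ρ)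
    (p : Fin N → ℝ) (_ : ∀ i, 0 < p i) (_ : ∑ i, p i = 1),
    limsup (fun r : ℝ =>
      (((∑ i, p i * Real.log (packingNumber (K ∩ ball (x i) ρ) r : ℝ)) / (-Real.log r) : ℝ)
        : EReal)) (𝓝[>] (0:ℝ))

/-- The maximal convex upper box dimension. -/
noncomputable def convUpperBoxDimMax {X : Type*} [MetricSpace X] (K : Set X) : EReal :=
  ⨆ (y : X) (_ : y ∈ K) (ρ : ℝ) (_ : 0 < ρ), convUpperBoxDim (K ∩ ball y ρ)

/-- `I_μ(r,q)`, with the logarithmic convention at `q = 1`. -/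
noncomputable def Iq {X : Type*} [MetricSpace X] [MeasurableSpace X]
    (μ : Measure X) (r q : ℝ) : ℝ :=
  if q = 1 then ∫ x, Real.log ((μ (ball x r)).toReal) ∂μ
  else ∫ x, ((μ (ball x r)).toReal) ^ (q - 1) ∂μ

/-- The quantity whose `liminf`/`limsup` as `r → 0⁺` gives the lower/upper `L^q`-dimensions. -/
noncomputable def Dq {X : Type*} [MetricSpace X] [MeasurableSpace X]
    (μ : Measure X) (r q : ℝ) : ℝ :=
  if q = 1 then Iq μ r 1 / Real.log r
  else (1 / (q - 1)) * (Real.log (Iq μ r q) / Real.log r)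

/-- The upper `L^q`-dimension of a measure. -/
noncomputable def upperDim {X : Type*} [MetricSpace X] [MeasurableSpace X]
    (μ : Measure X) (q : ℝ) : EReal :=
  limsup (fun r : ℝ => ((Dq μ r q : ℝ) : EReal)) (𝓝[>] (0:ℝ))

/-- The lower `L^q`-dimension of a measure. -/
noncomputable def lowerDim {X : Type*} [MetricSpace X] [MeasurableSpace X]
    (μ : Measure X) (q : ℝ) : EReal :=
  liminf (fun r : ℝ => ((Dq μ r q : ℝ) : EReal)) (𝓝[>] (0:ℝ))

/-- The (topological) support of a measure. -/
noncomputable def msupport {X : Type*} [MetricSpace X] [MeasurableSpace X]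
    (μ : Measure X) : Set X :=
  {x | ∀ r > (0:ℝ), 0 < μ (ball x r)}

/-- The upper `L^∞`-dimension of a measure. -/
noncomputable def upperDimInfty {X : Type*} [MetricSpace X] [MeasurableSpace X]
    (μ : Measure X) : EReal :=
  limsup (fun r : ℝ =>
    ((Real.log (⨆ x ∈ msupport μ, (μ (ball x r)).toReal) / Real.log r : ℝ) : EReal))
    (𝓝[>] (0:ℝ))

/-- The lower `L^∞`-dimension of a measure. -/
noncomputable def lowerDimInfty {X : Type*} [MetricSpace X] [MeasurableSpace X]
    (μ : Measure X) : EReal :=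
  liminf (fun r : ℝ =>
    ((Real.log (⨆ x ∈ msupport μ, (μ (ball x r)).toReal) / Real.log r : ℝ) : EReal))
    (𝓝[>] (0:ℝ))

/-- The upper `L^{-∞}`-dimension of a measure. -/
noncomputable def upperDimNegInfty {X : Type*} [MetricSpace X] [MeasurableSpace X]
    (μ : Measure X) : EReal :=
  limsup (fun r : ℝ =>
    ((Real.log (⨅ x ∈ msupport μ, (μ (ball x r)).toReal) / Real.log r : ℝ) : EReal))
    (𝓝[>] (0:ℝ))

/-- The lower `L^{-∞}`-dimension of a measure. -/
noncomputable def lowerDimNegInfty {X : Type*} [MetricSpace X] [MeasurableSpace X]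
    (μ : Measure X) : EReal :=
  liminf (fun r : ℝ =>
    ((Real.log (⨅ x ∈ msupport μ, (μ (ball x r)).toReal) / Real.log r : ℝ) : EReal))
    (𝓝[>] (0:ℝ))

/-- The half-closed dyadic cube of side `2^{-n}` indexed by `k`. -/
noncomputable def dyadicCube (d n : ℕ) (k : Fin d → ℤ) : Set (Euc d) :=
  {x | ∀ j, (k j : ℝ) / 2 ^ n ≤ x j ∧ x j < ((k j : ℝ) + 1) / 2 ^ n}

/-- `K_n`: the union of the half-closed dyadic cubes of side `2^{-n}` meeting `K`. -/
noncomputable def dyadicHull (d : ℕ) (K : Set (Euc d)) (n : ℕ) : Set (Euc d) :=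
  ⋃ (k : Fin d → ℤ) (_ : (dyadicCube d n k ∩ K).Nonempty), dyadicCube d n k

/-- The number of connected components of a set. -/
noncomputable def numComponents {X : Type*} [TopologicalSpace X] (S : Set X) : ℕ :=
  Nat.card {C : Set X // ∃ x ∈ S, C = connectedComponentIn S x}

/-- The box separation index `bsi(K)`. -/
noncomputable def bsi (d : ℕ) (K : Set (Euc d)) : ℝ :=
  liminf (fun n : ℕ =>
    Real.log (numComponents (dyadicHull d K n) : ℝ) / (n * Real.log 2)) atTop

/-- The Fortet–Mourier distance between two measures. -/
noncomputable def FMdist {X : Type*} [MetricSpace X] [MeasurableSpace X]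
    (μ ν : Measure X) : ℝ :=
  ⨆ f : {f : X → ℝ // LipschitzWith 1 f ∧ ∀ x, |f x| ≤ 1},
    |∫ x, f.1 x ∂μ - ∫ x, f.1 x ∂ν|


section TypicalMeasures

lemma exists_convexCombination {Ω : Type*} [MeasurableSpace Ω] (μ ν : ProbabilityMeasure Ω)
    {ε : ℝ} (h0 : 0 ≤ ε) (h1 : ε ≤ 1) :
    ∃ ρ : ProbabilityMeasure Ω, (ρ : Measure Ω) =
      ENNReal.ofReal (1 - ε) • (μ : Measure Ω) + ENNReal.ofReal ε • (ν : Measure Ω) := by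
  refine ⟨⟨_, ⟨?_⟩⟩, rfl⟩
  simp [← ENNReal.ofReal_add (sub_nonneg.2 h1) h0]

variable {X : Type*} [MetricSpace X] [MeasurableSpace X]

lemma bddBelow_measure_ball (μ : Measure X) (r : ℝ) :
    BddBelow (range fun x => (μ (ball x r)).toReal) :=
  ⟨0, by rintro _ ⟨x, rfl⟩; exact ENNReal.toReal_nonneg⟩

lemma le_toReal_measure_ball_of_mem_cover {μ : ProbabilityMeasure X} {t r : ℝ} (ht : 0 ≤ t)
    {F : Finset X} (hF : ∀ x, ∃ f ∈ F, dist x f < r)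
    (h : ∀ f ∈ F, ENNReal.ofReal t ≤ (μ : Measure X) (ball f r)) (x : X) :
    t ≤ ((μ : Measure X) (ball x (2 * r))).toReal := by
  obtain ⟨f, hf, hxf⟩ := hF x
  have : ENNReal.ofReal t ≤ (μ : Measure X) (ball x (2 * r)) :=
    (h f hf).trans (measure_mono (ball_subset_ball' (by rw [dist_comm]; linarith)))
  rw [← ENNReal.toReal_ofReal ht]
  exact ENNReal.toReal_mono (measure_ne_top _ _) this

/-- The probability measures which, at some scale `r < 1 / (n + 1)`, give mass more than `t r` to
each ball of some finite cover of the space by balls of radius `r`. -/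
def thickMeasures (X : Type*) [MetricSpace X] [MeasurableSpace X] (t : ℝ → ℝ) (n : ℕ) :
    Set (ProbabilityMeasure X) :=
  {μ | ∃ r : ℝ, 0 < r ∧ r < 1 / ((n : ℝ) + 1) ∧ ∃ F : Finset X, (∀ x, ∃ f ∈ F, dist x f < r) ∧
    ∀ f ∈ F, ENNReal.ofReal (t r) < (μ : Measure X) (ball f r)}

/-- The probability measures giving mass less than `r ^ n` to some ball of radius
`r < 1 / (n + 1)`. -/
def thinMeasures (X : Type*) [MetricSpace X] [MeasurableSpace X] (n : ℕ) :
    Set (ProbabilityMeasure X) :=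
  {μ | ∃ r : ℝ, 0 < r ∧ r < 1 / ((n : ℝ) + 1) ∧
    ∃ x, (μ : Measure X) (closedBall x r) < ENNReal.ofReal (r ^ n)}

lemma iInf_measure_ball_pos {μ : ProbabilityMeasure X}
    (h : ∀ n, μ ∈ thickMeasures X (fun _ => 0) n) {r : ℝ} (hr : 0 < r) :
    0 < ⨅ x, ((μ : Measure X) (ball x r)).toReal := by
  have hne : Nonempty X := μ.nonempty
  obtain ⟨n, hn⟩ := exists_nat_one_div_lt (half_pos hr)
  obtain ⟨s, hs0, hs, F, hF, hμ⟩ := h n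
  obtain ⟨f, hf, -⟩ := hF hne.some
  obtain ⟨f₀, hf₀, hmin⟩ := F.exists_min_image
    (fun f => ((μ : Measure X) (ball f s)).toReal) ⟨f, hf⟩
  have hpos : 0 < ((μ : Measure X) (ball f₀ s)).toReal :=
    ENNReal.toReal_pos (by simpa using (hμ f₀ hf₀).ne') (measure_ne_top _ _)
  refine hpos.trans_le (le_ciInf fun x => ?_)
  refine (le_toReal_measure_ball_of_mem_cover hpos.le hF (fun f hf => ?_) x).trans
    (ENNReal.toReal_mono (measure_ne_top _ _) (measure_mono (ball_subset_ball (by linarith))))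
  rw [ENNReal.ofReal_le_iff_le_toReal (measure_ne_top _ _)]
  exact hmin f hf

lemma iInf_msupport_eq {μ : ProbabilityMeasure X}
    (h : ∀ n, μ ∈ thickMeasures X (fun _ => 0) n) (r : ℝ) :
    ⨅ x ∈ msupport (μ : Measure X), ((μ : Measure X) (ball x r)).toReal
      = ⨅ x, ((μ : Measure X) (ball x r)).toReal := by
  congr 1
  ext x
  have hx : x ∈ msupport (μ : Measure X) := fun s hs => by
    have := (iInf_measure_ball_pos h hs).trans_le (ciInf_le (bddBelow_measure_ball _ s) x)
    exact (ENNReal.toReal_pos_iff.1 this).1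
  have : Nonempty (x ∈ msupport (μ : Measure X)) := ⟨hx⟩
  exact ciInf_const

lemma upperDimNegInfty_eq_top {μ : ProbabilityMeasure X}
    (h : ∀ n, μ ∈ thickMeasures X (fun _ => 0) n) (h' : ∀ n, μ ∈ thinMeasures X n) :
    upperDimNegInfty (μ : Measure X) = ⊤ := by
  rw [upperDimNegInfty, EReal.eq_top_iff_forall_lt]
  intro y
  obtain ⟨m, hm⟩ := exists_nat_gt y
  refine lt_of_lt_of_le (EReal.coe_lt_coe_iff.2 hm)
    (le_limsup_of_frequently_le ?_ (by isBoundedDefault))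
  rw [frequently_iff]
  intro U hU
  obtain ⟨δ, hδ, hδU⟩ := mem_nhdsGT_iff_exists_Ioo_subset.1 hU
  obtain ⟨k, hk⟩ := exists_nat_one_div_lt (show (0 : ℝ) < δ from hδ)
  obtain ⟨r, hr0, hr, x, hx⟩ := h' (max k m)
  have hkm : 1 / (((max k m : ℕ) : ℝ) + 1) ≤ 1 / ((k : ℝ) + 1) :=
    Nat.one_div_le_one_div (le_max_left _ _)
  have hr1 : r < 1 := hr.trans_le (by
    rw [div_le_one (by positivity)]; linarith [(max k m).cast_nonneg (α := ℝ)])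
  refine ⟨r, hδU ⟨hr0, by linarith⟩, ?_⟩
  rw [iInf_msupport_eq h]
  have hpos := iInf_measure_ball_pos h hr0
  have hle : ⨅ x, ((μ : Measure X) (ball x r)).toReal ≤ r ^ m := by
    refine (ciInf_le (bddBelow_measure_ball _ r) x).trans ?_
    refine ENNReal.toReal_le_of_le_ofReal (by positivity) ?_
    refine (measure_mono ball_subset_closedBall).trans (hx.le.trans ?_)
    exact ENNReal.ofReal_le_ofReal (pow_le_pow_of_le_one hr0.le hr1.le (le_max_right _ _))
  rw [EReal.coe_le_coe_iff, le_div_iff_of_neg (Real.log_neg hr0 hr1), ← Real.log_pow]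
  exact Real.log_le_log hpos hle

lemma lowerDimNegInfty_le {μ : ProbabilityMeasure X}
    (h : ∀ n, μ ∈ thickMeasures X (fun _ => 0) n) {s : ℝ}
    (h' : ∀ n, μ ∈ thickMeasures X (fun r => (2 * r) ^ s) n) :
    lowerDimNegInfty (μ : Measure X) ≤ s := by
  have hne : Nonempty X := μ.nonempty
  refine liminf_le_of_frequently_le ?_ (by isBoundedDefault)
  rw [frequently_iff]
  intro U hU
  obtain ⟨δ, hδ, hδU⟩ := mem_nhdsGT_iff_exists_Ioo_subset.1 hU
  obtain ⟨n, hn⟩ := exists_nat_one_div_lt (show (0 : ℝ) < min δ 1 / 2 from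
    half_pos (lt_min hδ one_pos))
  obtain ⟨r, hr0, hr, F, hF, hμ⟩ := h' n
  have h2r : 2 * r < min δ 1 := by linarith
  rw [lt_min_iff] at h2r
  refine ⟨2 * r, hδU ⟨by linarith [hr0], h2r.1⟩, ?_⟩
  rw [iInf_msupport_eq h, EReal.coe_le_coe_iff,
    div_le_iff_of_neg (Real.log_neg (by linarith) h2r.2), ← Real.log_rpow (by linarith)]
  exact Real.log_le_log (by positivity) (le_ciInf fun x =>
    le_toReal_measure_ball_of_mem_cover (by positivity) hF (fun f hf => (hμ f hf).le) x)

variable [BorelSpace X]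

lemma isOpen_setOf_lt_measure {U : Set X} (hU : IsOpen U) (c : ENNReal) :
    IsOpen {μ : ProbabilityMeasure X | c < (μ : Measure X) U} := by
  rw [isOpen_iff_eventually]
  intro μ hμ
  exact eventually_lt_of_lt_liminf
    (lt_of_lt_of_le hμ (ProbabilityMeasure.le_liminf_measure_open_of_tendsto tendsto_id hU))

lemma isOpen_setOf_measure_lt {C : Set X} (hC : IsClosed C) (c : ENNReal) :
    IsOpen {μ : ProbabilityMeasure X | (μ : Measure X) C < c} := by
  rw [isOpen_iff_eventually]
  intro μ hμ
  exact eventually_lt_of_limsup_lt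
    (lt_of_le_of_lt (ProbabilityMeasure.limsup_measure_closed_le_of_tendsto tendsto_id hC) hμ)

/-- Convex combinations with weights tending to `0` on the second measure converge to the first. -/
lemma tendsto_of_eq_convexCombination {μ : ProbabilityMeasure X} {ν ρ : ℕ → ProbabilityMeasure X}
    {ε : ℕ → ℝ} (hε0 : ∀ k, 0 ≤ ε k) (hε1 : ∀ k, ε k ≤ 1) (hε : Tendsto ε atTop (𝓝 0))
    (hρ : ∀ k, (ρ k : Measure X) =
      ENNReal.ofReal (1 - ε k) • (μ : Measure X) + ENNReal.ofReal (ε k) • (ν k : Measure X)) :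
    Tendsto ρ atTop (𝓝 μ) := by
  rw [ProbabilityMeasure.tendsto_iff_forall_integral_tendsto]
  intro f
  have hint : ∀ k, ∫ x, f x ∂(ρ k : Measure X) =
      (1 - ε k) * ∫ x, f x ∂(μ : Measure X) + ε k * ∫ x, f x ∂(ν k : Measure X) := by
    intro k
    rw [hρ k, integral_add_measure ((f.integrable _).smul_measure ENNReal.ofReal_ne_top)
      ((f.integrable _).smul_measure ENNReal.ofReal_ne_top), integral_smul_measure,
      integral_smul_measure, ENNReal.toReal_ofReal (by linarith [hε1 k]),
      ENNReal.toReal_ofReal (hε0 k), smul_eq_mul, smul_eq_mul]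
  simp_rw [hint]
  have h2 : Tendsto (fun k => ε k * ∫ x, f x ∂(ν k : Measure X)) atTop (𝓝 0) := by
    refine squeeze_zero_norm (a := fun k => ε k * ‖f‖) (fun k => ?_) (by simpa using hε.mul_const _)
    rw [norm_mul, Real.norm_of_nonneg (hε0 k)]
    gcongr
    · exact hε0 k
    · simpa using f.norm_integral_le_norm (ν k : Measure X)
  have h1 : Tendsto (fun k => (1 - ε k) * ∫ x, f x ∂(μ : Measure X)) atTop
      (𝓝 (∫ x, f x ∂(μ : Measure X))) := by
    simpa using (hε.const_sub 1).mul_const (∫ x, f x ∂(μ : Measure X))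
  simpa using h1.add h2

lemma exists_probabilityMeasure_singleton_ge (F : Finset X) (hF : F.Nonempty) :
    ∃ ν : ProbabilityMeasure X, ∀ f ∈ F, (F.card : ENNReal)⁻¹ ≤ (ν : Measure X) {f} := by
  refine ⟨⟨(PMF.uniformOfFinset F hF).toMeasure, inferInstance⟩, fun f hf => ?_⟩
  rw [ProbabilityMeasure.coe_mk, PMF.toMeasure_apply_singleton _ _ (measurableSet_singleton f),
    PMF.uniformOfFinset_apply_of_mem hF hf]

lemma isOpen_thickMeasures (t : ℝ → ℝ) (n : ℕ) : IsOpen (thickMeasures X t n) := by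
  have : thickMeasures X t n = ⋃ (r : ℝ) (_ : 0 < r ∧ r < 1 / ((n : ℝ) + 1)) (F : Finset X)
      (_ : ∀ x, ∃ f ∈ F, dist x f < r), ⋂ f ∈ F,
        {μ : ProbabilityMeasure X | ENNReal.ofReal (t r) < (μ : Measure X) (ball f r)} := by
    ext μ
    simp only [thickMeasures, mem_ofPred_eq, mem_iUnion, mem_iInter, exists_prop, and_assoc]
  rw [this]
  exact isOpen_iUnion fun r => isOpen_iUnion fun _ => isOpen_iUnion fun F => isOpen_iUnion fun _ =>
    isOpen_biInter_finset fun f _ => isOpen_setOf_lt_measure isOpen_ball _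

lemma isOpen_thinMeasures (n : ℕ) : IsOpen (thinMeasures X n) := by
  have : thinMeasures X n = ⋃ (r : ℝ) (_ : 0 < r ∧ r < 1 / ((n : ℝ) + 1)) (x : X),
        {μ : ProbabilityMeasure X | (μ : Measure X) (closedBall x r) < ENNReal.ofReal (r ^ n)} := by
    ext μ
    simp only [thinMeasures, mem_ofPred_eq, mem_iUnion, exists_prop, and_assoc]
  rw [this]
  exact isOpen_iUnion fun r => isOpen_iUnion fun _ => isOpen_iUnion fun x =>
    isOpen_setOf_measure_lt isClosed_closedBall _

lemma dense_thickMeasures {t : ℝ → ℝ}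
    (h : ∀ ε > 0, ∀ δ > 0, ∃ r : ℝ, 0 < r ∧ r < δ ∧ ∃ F : Finset X,
      (∀ x, ∃ f ∈ F, dist x f < r) ∧ t r * F.card < ε) (n : ℕ) :
    Dense (thickMeasures X t n) := by
  intro μ
  have hne : Nonempty X := μ.nonempty
  have hε0 : ∀ k : ℕ, (0 : ℝ) < 1 / ((k : ℝ) + 1) := fun k => Nat.one_div_pos_of_nat
  have hε1 : ∀ k : ℕ, 1 / ((k : ℝ) + 1) ≤ 1 := fun k => by
    rw [div_le_one (by positivity)]; linarith [k.cast_nonneg (α := ℝ)]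
  choose r hr0 hr1 F hF htF using fun k : ℕ => h _ (hε0 k) _ (hε0 n)
  have hFne : ∀ k, (F k).Nonempty := fun k =>
    let ⟨f, hf, _⟩ := hF k hne.some; ⟨f, hf⟩
  choose ν hν using fun k => exists_probabilityMeasure_singleton_ge (F k) (hFne k)
  choose ρ hρ using fun k => exists_convexCombination μ (ν k) (hε0 k).le (hε1 k)
  refine mem_closure_of_tendsto (tendsto_of_eq_convexCombination (fun k => (hε0 k).le) hε1
    tendsto_one_div_add_atTop_nhds_zero_nat hρ) (Eventually.of_forall fun k => ?_)
  refine ⟨r k, hr0 k, hr1 k, F k, hF k, fun f hf => ?_⟩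
  have hcard : (0 : ℝ) < (F k).card := by exact_mod_cast (hFne k).card_pos
  calc ENNReal.ofReal (t (r k))
      < ENNReal.ofReal (1 / ((k : ℝ) + 1) * ((F k).card : ℝ)⁻¹) := by
        rw [ENNReal.ofReal_lt_ofReal_iff (mul_pos (hε0 k) (inv_pos.2 hcard)), ← div_eq_mul_inv,
          lt_div_iff₀ hcard]
        exact htF k
    _ = ENNReal.ofReal (1 / ((k : ℝ) + 1)) * ((F k).card : ENNReal)⁻¹ := by
        rw [ENNReal.ofReal_mul (hε0 k).le, ENNReal.ofReal_inv_of_pos hcard,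
          ENNReal.ofReal_natCast]
    _ ≤ ENNReal.ofReal (1 / ((k : ℝ) + 1)) * (ν k : Measure X) (ball f (r k)) := by
        gcongr
        exact (hν k f hf).trans (measure_mono (singleton_subset_iff.2 (mem_ball_self (hr0 k))))
    _ ≤ (ρ k : Measure X) (ball f (r k)) := by
        rw [hρ k, Measure.add_apply, Measure.smul_apply, Measure.smul_apply, smul_eq_mul,
          smul_eq_mul]
        exact le_add_self

lemma dense_thinMeasures [CompactSpace X] [Infinite X] (n : ℕ) : Dense (thinMeasures X n) := by
  classical
  intro μ
  obtain ⟨z, hz⟩ := (Set.infinite_univ (α := X)).exists_accPt_principal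
  have hacc : ∀ δ > 0, ∃ x, x ≠ z ∧ dist x z < δ := by
    intro δ hδ
    rw [accPt_iff_nhds] at hz
    obtain ⟨y, ⟨hy, -⟩, hyz⟩ := hz _ (ball_mem_nhds z hδ)
    exact ⟨y, hyz, hy⟩
  have hδ0 : ∀ k : ℕ, (0 : ℝ) < 1 / ((k : ℝ) + 1) := fun k => Nat.one_div_pos_of_nat
  let T : ℕ → X → X := fun k x => if x ∈ ball z (1 / ((k : ℝ) + 1)) then z else x
  have hT : ∀ k, Measurable (T k) := fun k =>
    Measurable.ite measurableSet_ball measurable_const measurable_id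
  have hTlim : ∀ x, Tendsto (fun k => T k x) atTop (𝓝 x) := by
    intro x
    rw [tendsto_iff_dist_tendsto_zero]
    refine squeeze_zero (fun _ => dist_nonneg) (fun k => ?_)
      tendsto_one_div_add_atTop_nhds_zero_nat
    by_cases hx : x ∈ ball z (1 / ((k : ℝ) + 1))
    · simp only [T, if_pos hx]
      exact (mem_ball'.1 hx).le
    · simp only [T, if_neg hx, dist_self]
      exact (hδ0 k).le
  have hlim : Tendsto (fun k => μ.map (hT k).aemeasurable) atTop (𝓝 μ) := by
    rw [ProbabilityMeasure.tendsto_iff_forall_integral_tendsto]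
    intro f
    have : ∀ k, ∫ x, f x ∂(μ.map (hT k).aemeasurable : Measure X)
        = ∫ x, f (T k x) ∂(μ : Measure X) := fun k =>
      integral_map (hT k).aemeasurable f.continuous.aestronglyMeasurable
    simp_rw [this]
    refine tendsto_integral_of_dominated_convergence (fun _ => ‖f‖)
      (fun k => (f.continuous.measurable.comp (hT k)).aestronglyMeasurable) (integrable_const _)
      (fun k => Eventually.of_forall fun x => f.norm_coe_le_norm _)
      (Eventually.of_forall fun x => (f.continuous.tendsto x).comp (hTlim x))
  refine mem_closure_of_tendsto hlim (Eventually.of_forall fun k => ?_)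
  obtain ⟨x, hxz, hx⟩ := hacc _ (hδ0 k)
  obtain ⟨r, hr0, hr⟩ := exists_between (lt_min (dist_pos.2 hxz)
    (lt_min (sub_pos.2 hx) (hδ0 n)))
  rw [lt_min_iff, lt_min_iff] at hr
  refine ⟨r, hr0, hr.2.2, x, ?_⟩
  have hempty : T k ⁻¹' closedBall x r = ∅ := by
    ext y
    simp only [mem_preimage, mem_closedBall, mem_empty_iff_false, iff_false, not_le]
    by_cases hy : y ∈ ball z (1 / ((k : ℝ) + 1))
    · simp only [T, if_pos hy]
      rw [dist_comm]
      exact hr.1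
    · simp only [T, if_neg hy]
      rw [mem_ball, not_lt] at hy
      linarith [dist_triangle y x z]
  rw [ProbabilityMeasure.toMeasure_map, Measure.map_apply (hT k) measurableSet_closedBall, hempty,
    measure_empty]
  exact ENNReal.ofReal_pos.2 (pow_pos hr0 n)

end TypicalMeasures

section Covering

variable {Y : Type*} [MetricSpace Y] {K : Set Y}

lemma exists_finset_cover (hK : IsCompact K) {r : ℝ} (hr : 0 < r) :
    ∃ F : Finset K, (∀ x, ∃ f ∈ F, dist x f < 2 * r) ∧ F.card ≤ coveringNumber K r := by
  classical
  have hne : {n : ℕ | ∃ c : Fin n → Y, K ⊆ ⋃ i, ball (c i) r}.Nonempty := by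
    obtain ⟨t, -, htf, ht⟩ := hK.finite_cover_balls hr
    lift t to Finset Y using htf
    refine ⟨t.card, fun i => t.equivFin.symm i, fun x hx => ?_⟩
    obtain ⟨y, hy, hxy⟩ := mem_iUnion₂.1 (ht hx)
    exact mem_iUnion.2 ⟨t.equivFin ⟨y, hy⟩, by simpa using hxy⟩
  obtain ⟨c, hc⟩ := Nat.sInf_mem hne
  change K ⊆ ⋃ i : Fin (coveringNumber K r), ball (c i) r at hc
  rcases isEmpty_or_nonempty K with hemp | ⟨⟨x₀⟩⟩
  · exact ⟨∅, fun x => hemp.elim x, by simp⟩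
  have : ∀ i, ∃ k : K, ∀ x : K, (x : Y) ∈ ball (c i) r → dist x k < 2 * r := by
    intro i
    by_cases h : ∃ k : K, (k : Y) ∈ ball (c i) r
    · obtain ⟨k, hk⟩ := h
      refine ⟨k, fun x hx => ?_⟩
      rw [Subtype.dist_eq]
      rw [mem_ball] at hx hk
      linarith [dist_triangle_right (x : Y) k (c i)]
    · exact ⟨x₀, fun x hx => (h ⟨x, hx⟩).elim⟩
  choose k hk using this
  refine ⟨Finset.univ.image k, fun x => ?_, ?_⟩
  · obtain ⟨i, hi⟩ := mem_iUnion.1 (hc x.2)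
    exact ⟨k i, Finset.mem_image_of_mem _ (Finset.mem_univ _), hk i x hi⟩
  · exact Finset.card_image_le.trans (by rw [Finset.card_univ, Fintype.card_fin]; rfl)

lemma exists_finset_separated (K : Set Y) {r : ℝ} (hr : 0 < r) {n : ℕ}
    (hn : n ≤ coveringNumber K r) :
    ∃ F : Finset K, F.card = n ∧ (F : Set K).Pairwise fun x y => r ≤ dist x y := by
  classical
  induction n with
  | zero => exact ⟨∅, by simp⟩
  | succ n ih =>
    obtain ⟨F, hFc, hF⟩ := ih (by omega)
    have hnot : n ∉ {n : ℕ | ∃ c : Fin n → Y, K ⊆ ⋃ i, ball (c i) r} :=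
      Nat.notMem_of_lt_sInf (Nat.lt_of_succ_le hn)
    have hex : ∃ x : K, ∀ f ∈ F, r ≤ dist x f := by
      by_contra! hcon
      subst hFc
      refine hnot ⟨fun i => ((F.equivFin.symm i : K) : Y), fun x hx => ?_⟩
      obtain ⟨f, hf, hxf⟩ := hcon ⟨x, hx⟩
      exact mem_iUnion.2 ⟨F.equivFin ⟨f, hf⟩, by simpa [Subtype.dist_eq] using hxf⟩
    obtain ⟨x, hx⟩ := hex
    have hxF : x ∉ F := fun h => by
      have := hx x h
      rw [dist_self] at this
      linarith
    refine ⟨insert x F, by rw [Finset.card_insert_of_notMem hxF, hFc], ?_⟩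
    rw [Finset.coe_insert]
    refine hF.insert fun y hy _ => ⟨hx y hy, ?_⟩
    rw [dist_comm]
    exact hx y hy

lemma exists_fine_cover_of_lowerBoxDim_lt (hK : IsCompact K) {s : ℝ} (hs : lowerBoxDim K < s) :
    ∀ ε > 0, ∀ δ > 0, ∃ r : ℝ, 0 < r ∧ r < δ ∧ ∃ F : Finset K,
      (∀ x, ∃ f ∈ F, dist x f < r) ∧ (2 * r) ^ s * F.card < ε := by
  intro ε hε δ hδ
  obtain ⟨a, ha, has⟩ := EReal.lt_iff_exists_real_btwn.1 hs
  rw [EReal.coe_lt_coe_iff] at has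
  have hfreq := frequently_lt_of_liminf_lt (by isBoundedDefault) ha
  have hpow : Tendsto (fun ρ : ℝ => (4 : ℝ) ^ s * ρ ^ (s - a)) (𝓝[>] 0) (𝓝 0) := by
    have : Tendsto (fun ρ : ℝ => ρ ^ (s - a)) (𝓝[>] 0) (𝓝 0) := by
      have h := (Real.continuousAt_rpow_const 0 (s - a) (Or.inr (sub_pos.2 has).le)).tendsto
      rw [Real.zero_rpow (sub_pos.2 has).ne'] at h
      exact h.mono_left nhdsWithin_le_nhds
    simpa using this.const_mul ((4 : ℝ) ^ s)
  obtain ⟨ρ, hN, hρε, hρ0, hρ⟩ := (hfreq.and_eventually ((hpow.eventually_lt_const hε).and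
    (Ioo_mem_nhdsGT (show (0 : ℝ) < min 1 (δ / 2) by positivity)))).exists
  rw [lt_min_iff] at hρ
  obtain ⟨F, hF, hcard⟩ := exists_finset_cover hK hρ0
  refine ⟨2 * ρ, by linarith, by linarith, F, hF, lt_of_le_of_lt ?_ hρε⟩
  rw [EReal.coe_lt_coe_iff, div_lt_iff₀ (neg_pos.2 (Real.log_neg hρ0 hρ.1))] at hN
  have hNle : (F.card : ℝ) ≤ ρ ^ (-a) := by
    calc (F.card : ℝ) ≤ (coveringNumber K ρ : ℝ) := by exact_mod_cast hcard
      _ ≤ Real.exp (Real.log (coveringNumber K ρ : ℝ)) := Real.le_exp_log _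
      _ ≤ ρ ^ (-a) := by
        rw [Real.rpow_def_of_pos hρ0, Real.exp_le_exp]
        linarith
  calc (2 * (2 * ρ)) ^ s * (F.card : ℝ) ≤ (2 * (2 * ρ)) ^ s * ρ ^ (-a) := by gcongr
    _ = (4 : ℝ) ^ s * ρ ^ (s - a) := by
      rw [← mul_assoc, Real.mul_rpow (by norm_num) hρ0.le, mul_assoc, ← Real.rpow_add hρ0,
        sub_eq_add_neg]
      norm_num

variable [MeasurableSpace Y] [BorelSpace Y]

lemma coveringNumber_mul_iInf_measure_ball_le (μ : ProbabilityMeasure K) {r : ℝ} (hr : 0 < r) :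
    (coveringNumber K (2 * r) : ℝ) * ⨅ x, ((μ : Measure K) (ball x r)).toReal ≤ 1 := by
  obtain ⟨F, hFc, hF⟩ := exists_finset_separated K (show 0 < 2 * r by linarith) le_rfl
  have hdisj : (F : Set K).PairwiseDisjoint fun f => ball f r := fun x hx y hy hxy =>
    ball_disjoint_ball (by linarith [hF hx hy hxy])
  calc (coveringNumber K (2 * r) : ℝ) * ⨅ x, ((μ : Measure K) (ball x r)).toReal
      = ∑ f ∈ F, ⨅ x, ((μ : Measure K) (ball x r)).toReal := by
        rw [Finset.sum_const, hFc, nsmul_eq_mul]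
    _ ≤ ∑ f ∈ F, ((μ : Measure K) (ball f r)).toReal :=
        Finset.sum_le_sum fun f _ => ciInf_le (bddBelow_measure_ball _ r) f
    _ = (μ : Measure K).real (⋃ f ∈ F, ball f r) :=
        (measureReal_biUnion_finset hdisj fun _ _ => measurableSet_ball).symm
    _ ≤ 1 := measureReal_le_one

lemma lowerBoxDim_le_lowerDimNegInfty {μ : ProbabilityMeasure K}
    (h : ∀ n, μ ∈ thickMeasures K (fun _ => 0) n) :
    lowerBoxDim K ≤ lowerDimNegInfty (μ : Measure K) := by
  by_contra! hlt
  obtain ⟨a, ha, hab⟩ := EReal.lt_iff_exists_real_btwn.1 hlt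
  obtain ⟨b, hb, hbK⟩ := EReal.lt_iff_exists_real_btwn.1 hab
  rw [EReal.coe_lt_coe_iff] at hb
  refine absurd ha (not_lt.2 (le_liminf_of_le (by isBoundedDefault) ?_))
  have hdouble : Tendsto (fun r : ℝ => 2 * r) (𝓝[>] 0) (𝓝[>] 0) := by
    refine tendsto_nhdsWithin_iff.2 ⟨?_, ?_⟩
    · exact (by simpa using (continuous_const_mul (2 : ℝ)).tendsto 0 :
        Tendsto (fun r : ℝ => 2 * r) (𝓝 0) (𝓝 0)).mono_left nhdsWithin_le_nhds
    · filter_upwards [self_mem_nhdsWithin] with r hr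
      exact mul_pos two_pos (mem_Ioi.1 hr)
  have hcov := hdouble.eventually (eventually_lt_of_lt_liminf hbK)
  have hlog : ∀ᶠ r : ℝ in 𝓝[>] 0, Real.log r < -(|b| * Real.log 2 / (b - a)) :=
    Real.tendsto_log_nhdsGT_zero.eventually_lt_atBot _
  filter_upwards [hcov, hlog, Ioo_mem_nhdsGT (show (0 : ℝ) < 1 / 2 by norm_num)]
    with r hN hr ⟨hr0, hr1⟩
  have hpos := iInf_measure_ball_pos h hr0
  have hmul := coveringNumber_mul_iInf_measure_ball_le μ hr0
  rw [EReal.coe_lt_coe_iff, lt_div_iff₀ (neg_pos.2 (Real.log_neg (by linarith) (by linarith))),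
    Real.log_mul two_ne_zero hr0.ne'] at hN
  rw [iInf_msupport_eq h, EReal.coe_le_coe_iff,
    le_div_iff_of_neg (Real.log_neg hr0 (by linarith))]
  set m := ⨅ x, ((μ : Measure K) (ball x r)).toReal
  have hlogm : Real.log m ≤ -Real.log (coveringNumber K (2 * r) : ℝ) := by
    rcases Nat.eq_zero_or_pos (coveringNumber K (2 * r)) with h0 | h0
    · have hne : Nonempty K := μ.nonempty
      have : m ≤ 1 := (ciInf_le (bddBelow_measure_ball _ r) hne.some).trans measureReal_le_one
      simpa [h0] using Real.log_nonpos hpos.le this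
    · have h0' : (0 : ℝ) < coveringNumber K (2 * r) := by exact_mod_cast h0
      have := Real.log_nonpos (by positivity) hmul
      rw [Real.log_mul h0'.ne' hpos.ne'] at this
      linarith
  have hba : |b| * Real.log 2 < -Real.log r * (b - a) := by
    rw [← div_lt_iff₀ (sub_pos.2 hb)]
    linarith
  have hb2 : b * Real.log 2 ≤ |b| * Real.log 2 := by
    gcongr
    · exact le_abs_self b
  nlinarith

end Covering


/-- A typical measure on an infinite compact `K ⊆ ℝ^d` satisfies `D̲_μ(-∞) = dim̲_B(K)` and
`D̄_μ(-∞) = +∞`. -/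
theorem typical_dim_neg_infty (d : ℕ) (K : Set (Euc d))
    (hK : IsCompact K) (hKinf : K.Infinite) :
    ∃ G : Set (ProbabilityMeasure ↥K),
      G ⊆ {μ : ProbabilityMeasure ↥K |
        lowerDimNegInfty (μ : Measure ↥K) = lowerBoxDim K ∧
        upperDimNegInfty (μ : Measure ↥K) = (⊤ : EReal)} ∧
      Dense G ∧ IsGδ G := by
  have : CompactSpace K := isCompact_iff_compactSpace.1 hK
  have : Infinite K := hKinf.to_subtype
  let U : Option {q : ℚ // lowerBoxDim K < ((q : ℝ) : EReal)} → ℕ → Set (ProbabilityMeasure K) :=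
    fun o n => o.elim (thickMeasures K (fun _ => 0) n)
      fun q => thickMeasures K (fun r => (2 * r) ^ ((q : ℚ) : ℝ)) n
  have hUo : ∀ o n, IsOpen (U o n) := by
    rintro (_ | q) n
    · exact isOpen_thickMeasures _ n
    · exact isOpen_thickMeasures _ n
  have hUd : ∀ o n, Dense (U o n) := by
    rintro (_ | q) n
    · refine dense_thickMeasures (fun ε hε δ hδ => ?_) n
      obtain ⟨F, hF, -⟩ := exists_finset_cover hK (show 0 < δ / 4 by positivity)
      exact ⟨2 * (δ / 4), by positivity, by linarith, F, hF, by simpa using hε⟩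
    · exact dense_thickMeasures (exists_fine_cover_of_lowerBoxDim_lt hK q.2) n
  refine ⟨(⋂ o, ⋂ n, U o n) ∩ ⋂ n, thinMeasures K n, ?_, ?_, ?_⟩
  · rintro μ ⟨hμ, hμ'⟩
    simp only [mem_iInter] at hμ hμ'
    have h0 : ∀ n, μ ∈ thickMeasures K (fun _ => 0) n := hμ none
    refine ⟨le_antisymm ?_ (lowerBoxDim_le_lowerDimNegInfty h0), upperDimNegInfty_eq_top h0 hμ'⟩
    by_contra! hlt
    obtain ⟨q, hq, hq'⟩ := EReal.lt_iff_exists_rat_btwn.1 hlt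
    exact absurd hq' (not_lt.2 (lowerDimNegInfty_le h0 (hμ (some ⟨q, hq⟩))))
  · refine Dense.inter_of_Gδ (IsGδ.iInter fun o => IsGδ.iInter_of_isOpen (hUo o))
      (IsGδ.iInter_of_isOpen isOpen_thinMeasures) ?_
      (dense_iInter_of_isOpen isOpen_thinMeasures dense_thinMeasures)
    exact dense_iInter_of_Gδ (fun o => IsGδ.iInter_of_isOpen (hUo o))
      fun o => dense_iInter_of_isOpen (hUo o) (hUd o)
  · exact (IsGδ.iInter fun o => IsGδ.iInter_of_isOpen (hUo o)).inter
      (IsGδ.iInter_of_isOpen isOpen_thinMeasures)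

end
end

section
/- Let K be a compact subset of ℝ^d and let q < 1. There exists a constant C_q > 0 such that for any probability measure μ on K with finite support and any r > 0 satisfying μ(B(x,r)) > 0 for all x ∈ K, there exists δ > 0 such that every ν ∈ P(K) with L(μ,ν) < δ satisfies I_ν(2r,q) ≤ C_q · I_μ(r,q) and I_ν(r,q) ≥ C_q^{-1} · I_μ(2r,q). -/
open MeasureTheory Filter Metric Set Topology

noncomputable section

section FortetMourier

variable {X : Type*} [MetricSpace X] [MeasurableSpace X]

theorem FMdist_comm (μ ν : Measure X) : FMdist μ ν = FMdist ν μ := by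
  simp only [FMdist, abs_sub_comm]

theorem abs_integral_sub_le_FMdist (μ ν : Measure X) [IsProbabilityMeasure μ]
    [IsProbabilityMeasure ν] {f : X → ℝ} (hf : LipschitzWith 1 f) (hf1 : ∀ x, |f x| ≤ 1) :
    |∫ x, f x ∂μ - ∫ x, f x ∂ν| ≤ FMdist μ ν := by
  have bound (ρ : Measure X) [IsProbabilityMeasure ρ] {g : X → ℝ} (hg : ∀ x, |g x| ≤ 1) :
      |∫ x, g x ∂ρ| ≤ 1 := by
    simpa using norm_integral_le_of_norm_le_const (μ := ρ) (f := g) (C := 1) (ae_of_all _ hg)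
  refine le_ciSup (f := fun f : {f : X → ℝ // LipschitzWith 1 f ∧ ∀ x, |f x| ≤ 1} =>
    |∫ x, f.1 x ∂μ - ∫ x, f.1 x ∂ν|) ⟨2, ?_⟩ ⟨f, hf, hf1⟩
  rintro _ ⟨g, rfl⟩
  have h1 := bound μ g.2.2
  have h2 := bound ν g.2.2
  exact (abs_sub _ _).trans (by linarith)

theorem measureReal_le_thickening_add [BorelSpace X] (μ ν : Measure X) [IsProbabilityMeasure μ]
    [IsProbabilityMeasure ν] {ε κ : ℝ} (hε : 0 < ε) (hε1 : ε ≤ 1) (h : FMdist μ ν < κ * ε)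
    {A : Set X} (hA : MeasurableSet A) :
    μ.real A ≤ ν.real (thickening ε A) + κ := by
  rcases A.eq_empty_or_nonempty with rfl | hne
  · have h0 : 0 ≤ FMdist μ ν := Real.iSup_nonneg fun _ => abs_nonneg _
    have : 0 ≤ κ := (pos_of_mul_pos_left (h0.trans_lt h) hε.le).le
    simpa using this
  set f : X → ℝ := fun y => max 0 (ε - infDist y A) with hf
  have f_nonneg (y : X) : 0 ≤ f y := le_max_left _ _
  have f_le (y : X) : f y ≤ ε := max_le hε.le (by linarith [infDist_nonneg (x := y) (s := A)])
  have f_lip : LipschitzWith 1 f := by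
    refine LipschitzWith.of_le_add fun x y => ?_
    refine max_le (add_nonneg (f_nonneg y) dist_nonneg) ?_
    have h1 : ε - infDist y A ≤ f y := le_max_right _ _
    have h2 := infDist_le_infDist_add_dist (s := A) (x := y) (y := x)
    rw [dist_comm] at h2
    linarith
  have f_abs (y : X) : |f y| ≤ ε := by rw [abs_of_nonneg (f_nonneg y)]; exact f_le y
  have f_int (ρ : Measure X) [IsProbabilityMeasure ρ] : Integrable f ρ :=
    .of_bound f_lip.continuous.measurable.aestronglyMeasurable ε (ae_of_all _ f_abs)
  have lower : μ.real A * ε ≤ ∫ y, f y ∂μ := by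
    rw [← smul_eq_mul, ← integral_indicator_const ε hA]
    refine integral_mono ((integrable_const ε).indicator hA) (f_int μ) fun y => ?_
    by_cases hy : y ∈ A
    · simp [hy, hf, infDist_zero_of_mem hy]
    · simpa [hy] using f_nonneg y
  have upper : ∫ y, f y ∂ν ≤ ν.real (thickening ε A) * ε := by
    have hm : MeasurableSet (thickening ε A) := isOpen_thickening.measurableSet
    rw [← smul_eq_mul, ← integral_indicator_const ε hm]
    refine integral_mono (f_int ν) ((integrable_const ε).indicator hm) fun y => ?_
    by_cases hy : y ∈ thickening ε A
    · simpa [hy] using f_le y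
    · have := (mem_thickening_iff_infDist_lt hne).not.1 hy
      simp only [hy, not_false_eq_true, indicator_of_notMem]
      exact max_le le_rfl (by linarith)
  have key := (abs_integral_sub_le_FMdist μ ν f_lip fun y => (f_abs y).trans hε1).trans_lt h
  refine le_of_mul_le_mul_right ?_ hε
  linarith [(abs_lt.1 key).2]

end FortetMourier

theorem measurable_measureReal_ball {X : Type*} [MetricSpace X] [SecondCountableTopology X]
    [MeasurableSpace X] [BorelSpace X] (ν : Measure X) [SFinite ν] (r : ℝ) :
    Measurable fun x => ν.real (ball x r) := by
  have h : MeasurableSet {p : X × X | dist p.2 p.1 < r} :=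
    (isOpen_lt (by fun_prop) continuous_const).measurableSet
  exact (measurable_measure_prodMk_left (ν := ν) h).ennreal_toReal

section FiniteSupport

variable {X : Type*} [MeasurableSpace X]

theorem exists_mem_finset_of_measure_pos {μ : Measure X} {t : Finset X}
    (ht : μ (↑t : Set X)ᶜ = 0) {A : Set X} (hA : 0 < μ A) : ∃ a ∈ t, a ∈ A := by
  by_contra! h
  exact hA.ne' (measure_mono_null (fun x hx hxt => h x hxt hx) ht)

theorem exists_finset_atoms {μ : Measure X} [IsFiniteMeasure μ] {s : Finset X}
    (hs : μ (↑s : Set X)ᶜ = 0) :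
    ∃ t : Finset X, μ (↑t : Set X)ᶜ = 0 ∧ ∀ a ∈ t, 0 < μ.real {a} := by
  classical
  refine ⟨s.filter fun a => 0 < μ.real {a}, ?_, by simp⟩
  refine measure_mono_null (t := (↑s : Set X)ᶜ ∪ ⋃ a ∈ s.filter (fun a => μ {a} = 0), {a}) ?_ ?_
  · intro x hx
    by_cases hxs : x ∈ s
    · right
      have : μ {x} = 0 := by
        by_contra h0
        have hpos : 0 < μ.real {x} := ENNReal.toReal_pos h0 (measure_ne_top _ _)
        exact hx (by simp [hxs, hpos])
      simp [hxs, this]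
    · exact Or.inl hxs
  · refine measure_union_null hs ((measure_biUnion_null_iff (Finset.countable_toSet _)).2 ?_)
    simp

theorem integral_eq_sum_of_measure_compl_finset [MeasurableSingletonClass X]
    {μ : Measure X} [IsFiniteMeasure μ] {t : Finset X}
    (ht : μ (↑t : Set X)ᶜ = 0) (f : X → ℝ) : ∫ x, f x ∂μ = ∑ a ∈ t, μ.real {a} * f a := by
  have hμ : μ.restrict (↑t : Set X) = μ :=
    Measure.restrict_eq_self_of_ae_mem (ae_iff.2 ht)
  rw [← hμ, setIntegral_finset t .finset, hμ]
  simp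

end FiniteSupport

/-- A scale adapted to a finite `r`-net: the points of the net are `2 * ε`-separated, and the net
is still an `(r - ε)`-net. -/
theorem exists_scale {X : Type*} [MetricSpace X] [CompactSpace X] {t : Finset X} {r : ℝ}
    (hr : 0 < r) (h : ∀ x, ∃ a ∈ t, dist x a < r) :
    ∃ ε > 0, ε ≤ 1 ∧ ε ≤ r / 2 ∧ (∀ a ∈ t, ∀ b ∈ t, a ≠ b → 2 * ε ≤ dist a b) ∧
      ∀ x, ∃ a ∈ t, dist x a < r - ε := by
  have small {c : ℝ} (hc : 0 < c) : ∀ᶠ ε in 𝓝[>] (0 : ℝ), ε ≤ c :=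
    nhdsWithin_le_nhds (Iic_mem_nhds hc)
  have sep : ∀ᶠ ε in 𝓝[>] (0 : ℝ), ∀ a ∈ t, ∀ b ∈ t, a ≠ b → 2 * ε ≤ dist a b := by
    simp only [Finset.eventually_all, eventually_imp_distrib_left]
    intro a _ b _ hab
    filter_upwards [small (half_pos (dist_pos.2 hab))] with ε hε
    linarith
  have net : ∀ᶠ ε in 𝓝[>] (0 : ℝ), ∀ x, ∃ a ∈ t, dist x a < r - ε := by
    rcases isEmpty_or_nonempty X with hX | ⟨⟨x₀⟩⟩
    · exact Eventually.of_forall fun _ x => isEmptyElim x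
    have hne : (↑t : Set X).Nonempty := (h x₀).imp fun _ ha => ha.1
    obtain ⟨m, -, hm⟩ := isCompact_univ.exists_isMaxOn ⟨x₀, mem_univ x₀⟩
      (continuous_infDist_pt (↑t : Set X)).continuousOn
    have hmr : infDist m (↑t : Set X) < r := (infDist_lt_iff hne).2 (h m)
    filter_upwards [small (half_pos (sub_pos.2 hmr))] with ε hε x
    refine (infDist_lt_iff hne).1 ?_
    have hx : infDist x (↑t : Set X) ≤ infDist m (↑t : Set X) := hm (mem_univ x)
    linarith
  obtain ⟨ε, h0, h1, h2, h3, h4⟩ := (eventually_mem_nhdsWithin.and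
    ((small one_pos).and ((small (half_pos hr)).and (sep.and net)))).exists
  exact ⟨ε, h0, h1, h2, h3, h4⟩

section BallSums

variable {X : Type*} [MetricSpace X] [MeasurableSpace X] [BorelSpace X] {ν : Measure X}
  {t : Finset X} {ε B : ℝ} {g : X → ℝ}

theorem integral_eq_sum_setIntegral_ball_add
    (hsep : ∀ a ∈ t, ∀ b ∈ t, a ≠ b → 2 * ε ≤ dist a b) (hg : Integrable g ν) :
    ∫ x, g x ∂ν = ∑ a ∈ t, ∫ x in ball a ε, g x ∂ν + ∫ x in (⋃ a ∈ t, ball a ε)ᶜ, g x ∂ν := by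
  rw [← integral_biUnion_finset t (fun a _ => measurableSet_ball) ?_ fun a _ => hg.integrableOn,
    integral_add_compl (t.measurableSet_biUnion fun a _ => measurableSet_ball) hg]
  exact fun a ha b hb hab => ball_disjoint_ball (by linarith [hsep a ha b hb hab])

variable [IsFiniteMeasure ν]

theorem integral_le_sum_ball_add (hsep : ∀ a ∈ t, ∀ b ∈ t, a ≠ b → 2 * ε ≤ dist a b)
    (hg : Integrable g ν) (hB : ∀ x, g x ≤ B) {M : X → ℝ}
    (hM : ∀ a ∈ t, ∀ x ∈ ball a ε, g x ≤ M a) :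
    ∫ x, g x ∂ν ≤ ∑ a ∈ t, ν.real (ball a ε) * M a + ν.real (⋃ a ∈ t, ball a ε)ᶜ * B := by
  rw [integral_eq_sum_setIntegral_ball_add hsep hg]
  refine add_le_add (Finset.sum_le_sum fun a ha => ?_) ?_
  · rw [← smul_eq_mul, ← setIntegral_const]
    exact setIntegral_mono_on hg.integrableOn integrableOn_const measurableSet_ball (hM a ha)
  · rw [← smul_eq_mul, ← setIntegral_const]
    exact integral_mono hg.integrableOn (integrable_const B) hB

theorem sum_ball_le_integral (hsep : ∀ a ∈ t, ∀ b ∈ t, a ≠ b → 2 * ε ≤ dist a b)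
    (hg : Integrable g ν) (hg0 : ∀ x, 0 ≤ g x) {m : X → ℝ}
    (hm : ∀ a ∈ t, ∀ x ∈ ball a ε, m a ≤ g x) :
    ∑ a ∈ t, ν.real (ball a ε) * m a ≤ ∫ x, g x ∂ν := by
  rw [integral_eq_sum_setIntegral_ball_add hsep hg]
  refine le_add_of_le_of_nonneg (Finset.sum_le_sum fun a ha => ?_)
    (setIntegral_nonneg_ae (t.measurableSet_biUnion fun a _ => measurableSet_ball).compl
      (ae_of_all _ fun x _ => hg0 x))
  rw [← smul_eq_mul, ← setIntegral_const]
  exact setIntegral_mono_on integrableOn_const hg.integrableOn measurableSet_ball (hm a ha)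

end BallSums

theorem integrable_measureReal_ball_rpow {X : Type*} [MetricSpace X] [SecondCountableTopology X]
    [MeasurableSpace X] [BorelSpace X] (ν : Measure X) [IsFiniteMeasure ν] {r s c : ℝ}
    (hc : 0 < c) (hs : s ≤ 0) (h : ∀ x, c ≤ ν.real (ball x r)) :
    Integrable (fun x => ν.real (ball x r) ^ s) ν := by
  refine .of_bound ((measurable_measureReal_ball ν r).pow_const s).aestronglyMeasurable (c ^ s)
    (ae_of_all _ fun x => ?_)
  rw [Real.norm_of_nonneg (Real.rpow_nonneg measureReal_nonneg s)]
  exact Real.rpow_le_rpow_of_nonpos hc (h x) hs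

section Comparison

variable {X : Type*} [MetricSpace X] [SecondCountableTopology X] [MeasurableSpace X]
  [BorelSpace X] {μ ν : Measure X} [IsProbabilityMeasure μ] [IsProbabilityMeasure ν]
  {t : Finset X} {r ε κ p s : ℝ}

theorem integral_measureReal_ball_rpow_le (ht : μ (↑t : Set X)ᶜ = 0) (hp : 0 < p)
    (hpt : ∀ a ∈ t, p ≤ μ.real {a}) (hε : 0 < ε) (hε1 : ε ≤ 1) (hεr : ε ≤ r / 2)
    (hsep : ∀ a ∈ t, ∀ b ∈ t, a ≠ b → 2 * ε ≤ dist a b)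
    (hnet : ∀ x, ∃ a ∈ t, dist x a < r - ε) (hs : s ≤ 0)
    (hκp : κ ≤ p / 2) (hκs : κ * (p / 2) ^ s ≤ 1) (hμν : FMdist μ ν < κ * ε) :
    ∫ x, ν.real (ball x (2 * r)) ^ s ∂ν ≤
      (2 * (1 / 2) ^ s + 1) * ∫ x, μ.real (ball x r) ^ s ∂μ := by
  have hνμ : FMdist ν μ < κ * ε := FMdist_comm μ ν ▸ hμν
  have half_le {x : X} {ρ : ℝ} (hρ : r - ε ≤ ρ) :
      p ≤ μ.real (ball x ρ) ∧ 1 / 2 * μ.real (ball x ρ) ≤ ν.real (ball x (ρ + ε)) := by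
    obtain ⟨a, ha, hxa⟩ := hnet x
    have h1 : p ≤ μ.real (ball x ρ) := (hpt a ha).trans <| measureReal_mono <|
      singleton_subset_iff.2 <| mem_ball'.2 <| hxa.trans_le hρ
    have h2 := measureReal_le_thickening_add μ ν hε hε1 hμν (measurableSet_ball (x := x) (ε := ρ))
    have h3 : ν.real (thickening ε (ball x ρ)) ≤ ν.real (ball x (ρ + ε)) :=
      measureReal_mono ((thickening_ball x ε ρ).trans (ball_subset_ball (by linarith)))
    exact ⟨h1, by linarith⟩
  have hlow (x : X) : p / 2 ≤ ν.real (ball x (2 * r)) := by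
    obtain ⟨h1, h2⟩ := half_le (x := x) (ρ := 2 * r - ε) (by linarith)
    rw [sub_add_cancel] at h2
    linarith
  have hint := integrable_measureReal_ball_rpow ν (half_pos hp) hs hlow
  have hnear (a : X) (ha : a ∈ t) (x : X) (hx : x ∈ ball a ε) :
      ν.real (ball x (2 * r)) ^ s ≤ (1 / 2) ^ s * μ.real (ball a r) ^ s := by
    obtain ⟨h1, h2⟩ := half_le (x := a) (ρ := r) (by linarith)
    rw [← Real.mul_rpow (by norm_num) measureReal_nonneg]
    refine Real.rpow_le_rpow_of_nonpos (by linarith) (h2.trans (measureReal_mono ?_)) hs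
    refine ball_subset_ball' ?_
    rw [dist_comm]
    linarith [mem_ball.1 hx]
  have hfar : ν.real (⋃ a ∈ t, ball a ε)ᶜ ≤ κ := by
    have h1 := measureReal_le_thickening_add ν μ hε hε1 hνμ
      (t.measurableSet_biUnion fun a _ => measurableSet_ball (x := a) (ε := ε)).compl
    have h2 : μ.real (thickening ε (⋃ a ∈ t, ball a ε)ᶜ) = 0 := by
      rw [measureReal_eq_zero_iff]
      refine measure_mono_null (t := (↑t : Set X)ᶜ) (fun x hx hxt => ?_) ht
      obtain ⟨y, hy, hxy⟩ := mem_thickening_iff.1 hx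
      exact hy (mem_biUnion hxt (mem_ball'.2 hxy))
    linarith
  have hmass (a : X) (ha : a ∈ t) : ν.real (ball a ε) ≤ 2 * μ.real {a} := by
    have h1 := measureReal_le_thickening_add ν μ hε hε1 hνμ (measurableSet_ball (x := a) (ε := ε))
    have h2 : μ.real (thickening ε (ball a ε)) ≤ μ.real {a} := by
      refine ENNReal.toReal_mono (measure_ne_top _ _) (measure_mono_ae ?_)
      filter_upwards [measure_eq_zero_iff_ae_notMem.1 ht] with x hx hxa
      by_contra hne
      have h3 := hsep x (by simpa using hx) a ha hne
      have h4 := mem_ball.1 (thickening_ball a ε ε hxa)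
      linarith
    linarith [hpt a ha]
  have hone : 1 ≤ ∫ x, μ.real (ball x r) ^ s ∂μ := by
    have hi := integrable_measureReal_ball_rpow μ hp hs
      fun x => (half_le (x := x) (ρ := r) (by linarith)).1
    have := integral_mono (integrable_const 1) hi fun x =>
      Real.one_le_rpow_of_pos_of_le_one_of_nonpos
        (hp.trans_le (half_le (x := x) (ρ := r) (by linarith)).1) measureReal_le_one hs
    simpa using this
  have hsum : ∑ a ∈ t, ν.real (ball a ε) * ((1 / 2) ^ s * μ.real (ball a r) ^ s) ≤
      2 * (1 / 2) ^ s * ∫ x, μ.real (ball x r) ^ s ∂μ := by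
    rw [integral_eq_sum_of_measure_compl_finset ht, Finset.mul_sum]
    refine Finset.sum_le_sum fun a ha => ?_
    calc _ ≤ 2 * μ.real {a} * ((1 / 2) ^ s * μ.real (ball a r) ^ s) := by
          gcongr; exact hmass a ha
      _ = _ := by ring
  have hrest : ν.real (⋃ a ∈ t, ball a ε)ᶜ * (p / 2) ^ s ≤ 1 :=
    (mul_le_mul_of_nonneg_right hfar (by positivity)).trans hκs
  have := integral_le_sum_ball_add hsep hint
    (fun x => Real.rpow_le_rpow_of_nonpos (half_pos hp) (hlow x) hs) hnear
  linarith

theorem le_integral_measureReal_ball_rpow (ht : μ (↑t : Set X)ᶜ = 0) (hp : 0 < p)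
    (hpt : ∀ a ∈ t, p ≤ μ.real {a}) (hε : 0 < ε) (hε1 : ε ≤ 1) (hεr : ε ≤ r / 2)
    (hsep : ∀ a ∈ t, ∀ b ∈ t, a ≠ b → 2 * ε ≤ dist a b)
    (hnet : ∀ x, ∃ a ∈ t, dist x a < r - ε) (hs : s ≤ 0)
    (hκp : κ ≤ p / 2) (hμν : FMdist μ ν < κ * ε) :
    (2 * (1 / 2) ^ s)⁻¹ * ∫ x, μ.real (ball x (2 * r)) ^ s ∂μ ≤
      ∫ x, ν.real (ball x r) ^ s ∂ν := by
  have hνμ : FMdist ν μ < κ * ε := FMdist_comm μ ν ▸ hμν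
  have hmass (a : X) (ha : a ∈ t) : 1 / 2 * μ.real {a} ≤ ν.real (ball a ε) := by
    have h1 := measureReal_le_thickening_add μ ν hε hε1 hμν (measurableSet_singleton a)
    rw [thickening_singleton] at h1
    linarith [hpt a ha]
  have hlow (x : X) : p / 2 ≤ ν.real (ball x r) := by
    obtain ⟨a, ha, hxa⟩ := hnet x
    have h1 : ν.real (ball a ε) ≤ ν.real (ball x r) := by
      refine measureReal_mono (ball_subset_ball' ?_)
      rw [dist_comm]
      linarith
    linarith [hmass a ha, hpt a ha]
  have hint := integrable_measureReal_ball_rpow ν (half_pos hp) hs hlow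
  have hnear (a : X) (ha : a ∈ t) (x : X) (hx : x ∈ ball a ε) :
      2 ^ s * μ.real (ball a (2 * r)) ^ s ≤ ν.real (ball x r) ^ s := by
    rw [← Real.mul_rpow (by norm_num) measureReal_nonneg]
    refine Real.rpow_le_rpow_of_nonpos ((half_pos hp).trans_le (hlow x)) ?_ hs
    have h1 : ν.real (ball x r) ≤ ν.real (ball a (r + ε)) :=
      measureReal_mono (ball_subset_ball' (by linarith [mem_ball.1 hx]))
    have h2 := measureReal_le_thickening_add ν μ hε hε1 hνμ
      (measurableSet_ball (x := a) (ε := r + ε))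
    have h3 : μ.real (thickening ε (ball a (r + ε))) ≤ μ.real (ball a (2 * r)) :=
      measureReal_mono ((thickening_ball a ε (r + ε)).trans (ball_subset_ball (by linarith)))
    have h4 : μ.real {a} ≤ μ.real (ball a (2 * r)) :=
      measureReal_mono (singleton_subset_iff.2 (mem_ball_self (by linarith)))
    linarith [hpt a ha]
  refine le_trans ?_ (sum_ball_le_integral hsep hint
    (fun x => Real.rpow_nonneg measureReal_nonneg s) hnear)
  rw [integral_eq_sum_of_measure_compl_finset ht, Finset.mul_sum]
  refine Finset.sum_le_sum fun a ha => ?_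
  calc _ = 1 / 2 * μ.real {a} * (2 ^ s * μ.real (ball a (2 * r)) ^ s) := by
        rw [one_div, Real.inv_rpow zero_le_two, mul_inv, inv_inv]; ring
    _ ≤ _ := by gcongr; exact hmass a ha

end Comparison

/-- Stability of `I_μ(r,q)`, `q < 1`, under small Fortet–Mourier perturbations of a finitely
supported measure all of whose balls of radius `r` have positive mass. -/
theorem Iq_stable_q_lt_one (d : ℕ) (K : Set (Euc d)) (hK : IsCompact K)
    (q : ℝ) (hq : q < 1) :
    ∃ C > (0:ℝ), ∀ μ : ProbabilityMeasure ↥K,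
      (∃ s : Finset ↥K, (μ : Measure ↥K) ((↑s : Set ↥K)ᶜ) = 0) →
      ∀ r > (0:ℝ), (∀ x : ↥K, 0 < (μ : Measure ↥K) (ball x r)) →
        ∃ δ > (0:ℝ), ∀ ν : ProbabilityMeasure ↥K,
          FMdist (μ : Measure ↥K) (ν : Measure ↥K) < δ →
            Iq (ν : Measure ↥K) (2*r) q ≤ C * Iq (μ : Measure ↥K) r q ∧
            C⁻¹ * Iq (μ : Measure ↥K) (2*r) q ≤ Iq (ν : Measure ↥K) r q := by
  have hs : q - 1 ≤ 0 := by linarith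
  have : CompactSpace ↥K := isCompact_iff_compactSpace.1 hK
  refine ⟨2 * (1 / 2) ^ (q - 1) + 1, by positivity, fun μ ⟨s, hsμ⟩ r hr hμr => ?_⟩
  obtain ⟨t, ht, htpos⟩ := exists_finset_atoms hsμ
  obtain ⟨ε, hε, hε1, hεr, hsep, hnet⟩ := exists_scale (t := t) hr fun x => by
    obtain ⟨a, ha, hax⟩ := exists_mem_finset_of_measure_pos ht (hμr x)
    exact ⟨a, ha, mem_ball'.1 hax⟩
  obtain ⟨x₀⟩ : Nonempty ↥K := nonempty_of_isProbabilityMeasure (μ : Measure ↥K)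
  obtain ⟨b, hb, hbmin⟩ := t.exists_min_image (fun a => (μ : Measure ↥K).real {a})
    ((hnet x₀).imp fun _ h => h.1)
  set p := (μ : Measure ↥K).real {b}
  have hp : 0 < p := htpos b hb
  have hps : 0 < (p / 2) ^ (q - 1) := by positivity
  set κ := min (p / 2) ((p / 2) ^ (q - 1))⁻¹
  have hκ : 0 < κ := lt_min (half_pos hp) (inv_pos.2 hps)
  have hκp : κ ≤ p / 2 := min_le_left _ _
  have hκs : κ * (p / 2) ^ (q - 1) ≤ 1 := by
    rw [← le_div_iff₀ hps, one_div]
    exact min_le_right _ _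
  refine ⟨κ * ε, mul_pos hκ hε, fun ν hν => ?_⟩
  simp only [Iq, if_neg hq.ne]
  refine ⟨integral_measureReal_ball_rpow_le ht hp hbmin hε hε1 hεr hsep hnet hs hκp hκs hν,
    le_trans ?_ (le_integral_measureReal_ball_rpow ht hp hbmin hε hε1 hεr hsep hnet hs hκp hν)⟩
  refine mul_le_mul_of_nonneg_right ?_
    (integral_nonneg fun x => Real.rpow_nonneg measureReal_nonneg _)
  exact inv_anti₀ (by positivity) (by linarith)

end
end

section
/- Let K be a compact subset of ℝ^d, let A ⊂ K, let μ ∈ P(K) and let r > 0. Then ∫_A log μ(B(x,2r)) dμ(x) ≥ −μ(A(r))·log N_r(A) − e^{-1}, where A(r) = {x ∈ K : dist(x,A) < r} and N_r(A) is the smallest number of balls of radius r needed to cover A. -/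
open MeasureTheory Filter Metric Set Topology

noncomputable section

/-- Tangent line inequality for the convex function `t ↦ t log t`. -/
lemma mul_log_add_sub_le_mul_log {t s : ℝ} (ht : 0 ≤ t) (hs : 0 < s) :
    t * Real.log s + t - s ≤ t * Real.log t := by
  rcases ht.eq_or_lt with rfl | ht
  · simp [hs.le]
  · have h := Real.log_le_sub_one_of_pos (div_pos hs ht)
    rw [Real.log_div hs.ne' ht.ne'] at h
    have h' := mul_le_mul_of_nonneg_left h ht.le
    have : t * (s / t - 1) = s - t := by field_simp
    linarith

/-- A finite sum of terms `p log p` is at least `-(∑ p) log N - e⁻¹`. -/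
lemma neg_sum_mul_log_card_sub_le_sum_mul_log {N : ℕ} (hN : 0 < N) (p : Fin N → ℝ)
    (hp : ∀ i, 0 ≤ p i) :
    -(∑ i, p i) * Real.log N - Real.exp (-1) ≤ ∑ i, p i * Real.log (p i) := by
  have hN' : (0 : ℝ) < N := by exact_mod_cast hN
  calc -(∑ i, p i) * Real.log N - Real.exp (-1)
      = ∑ i, (p i * Real.log (Real.exp (-1) / N) + p i - Real.exp (-1) / N) := by
        rw [Real.log_div (Real.exp_pos _).ne' hN'.ne', Real.log_exp,
          Finset.sum_sub_distrib, Finset.sum_add_distrib, ← Finset.sum_mul]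
        simp only [Finset.sum_const, Finset.card_univ, Fintype.card_fin, nsmul_eq_mul]
        field_simp
        ring
    _ ≤ _ := Finset.sum_le_sum fun i _ =>
        mul_log_add_sub_le_mul_log (hp i) (by positivity)

/-- In a compact space the infimum defining the covering number is attained. -/
lemma exists_cover_coveringNumber {X : Type*} [MetricSpace X] [CompactSpace X] (E : Set X)
    {r : ℝ} (hr : 0 < r) :
    ∃ c : Fin (coveringNumber E r) → X, E ⊆ ⋃ i, ball (c i) r := by
  refine Nat.sInf_mem (s := {n : ℕ | ∃ c : Fin n → X, E ⊆ ⋃ i, ball (c i) r}) ?_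
  obtain ⟨t, -, ht, hcov⟩ := finite_cover_balls_of_compact (isCompact_univ (X := X)) hr
  have := ht.fintype
  refine ⟨Fintype.card t, fun i => (Fintype.equivFin t).symm i, fun x _ => ?_⟩
  obtain ⟨y, hy, hxy⟩ := mem_iUnion₂.1 (hcov (mem_univ x))
  exact mem_iUnion.2 ⟨Fintype.equivFin t ⟨y, hy⟩, by simpa using hxy⟩

/-- If finitely many balls of radius `r` cover `A`, the entropy integral at scale `2r` is bounded
below in terms of the number of balls. -/
lemma entropy_integral_ge_of_cover {X : Type*} [MetricSpace X] [MeasurableSpace X]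
    [OpensMeasurableSpace X] (μ : Measure X) [IsProbabilityMeasure μ] {A : Set X} {r : ℝ}
    {N : ℕ} (hN : 0 < N) (c : Fin N → X) (hA : A ⊆ ⋃ i, ball (c i) r) :
    -μ.real A * Real.log N - Real.exp (-1)
      ≤ ∫ x in A, Real.log ((μ (ball x (2 * r))).toReal) ∂μ := by
  by_cases hint : Integrable (fun x => Real.log ((μ (ball x (2 * r))).toReal)) (μ.restrict A)
  swap
  · rw [integral_undef hint]
    have := mul_nonneg (measureReal_nonneg (μ := μ) (s := A)) (Real.log_natCast_nonneg N)
    have := Real.exp_pos (-1)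
    linarith
  set ν := μ.restrict A
  set D := disjointed fun i => ball (c i) r
  have hDm : ∀ i, MeasurableSet (D i) := fun i =>
    disjointedRec (fun _ _ ht => ht.diff measurableSet_ball) measurableSet_ball
  have hDdisj : Pairwise (Function.onFun Disjoint D) := disjoint_disjointed _
  have hDsub : ∀ i, D i ⊆ ball (c i) r := fun i => disjointed_le _ i
  have hDU : ⋃ i, D i = ⋃ i, ball (c i) r := iUnion_disjointed
  have hcover : ∀ᵐ x ∂ν, x ∈ ⋃ i, D i := by
    rw [hDU]
    exact (ae_restrict_mem (.iUnion fun _ => measurableSet_ball)).filter_mono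
      (ae_mono (Measure.restrict_mono hA le_rfl))
  have hsum : ∑ i, ν.real (D i) = μ.real A := by
    rw [← measureReal_iUnion_fintype hDdisj hDm]
    have : ν.real (⋃ i, D i) = ν.real univ :=
      measureReal_congr (eventuallyEq_univ.2 hcover)
    rw [this, measureReal_restrict_apply MeasurableSet.univ, univ_inter]
  have hpos : ∀ᵐ x ∂ν, ∀ i, x ∈ D i → ν (D i) ≠ 0 := by
    refine ae_all_iff.2 fun i => ?_
    by_cases h : ν (D i) = 0
    · filter_upwards [measure_eq_zero_iff_ae_notMem.1 h] with x hx hx'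
      exact absurd hx' hx
    · exact .of_forall fun _ _ => h
  calc -μ.real A * Real.log N - Real.exp (-1)
      ≤ ∑ i, ν.real (D i) * Real.log (ν.real (D i)) := by
        rw [← hsum]
        exact neg_sum_mul_log_card_sub_le_sum_mul_log hN _ fun _ => measureReal_nonneg
    _ = ∫ x, ∑ i, (D i).indicator (fun _ => Real.log (ν.real (D i))) x ∂ν := by
        rw [integral_finsetSum _ fun i _ => (integrable_const _).indicator (hDm i)]
        exact Finset.sum_congr rfl fun i _ => by
          rw [integral_indicator_const _ (hDm i), smul_eq_mul]
    _ ≤ _ := by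
        refine integral_mono_ae
          (integrable_finsetSum _ fun i _ => (integrable_const _).indicator (hDm i)) hint ?_
        filter_upwards [hcover, hpos] with x hx hx'
        obtain ⟨i, hi⟩ := mem_iUnion.1 hx
        rw [Finset.sum_eq_single i
          (fun j _ hj => indicator_of_notMem
            (fun h => (hDdisj hj).le_bot ⟨h, hi⟩) _) (by simp), indicator_of_mem hi]
        have hsub : D i ⊆ ball x (2 * r) := fun y hy => by
          have hy' : dist y (c i) < r := hDsub i hy
          have hx' : dist x (c i) < r := hDsub i hi
          have := dist_triangle_right y x (c i)
          rw [mem_ball]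
          linarith
        refine Real.log_le_log (ENNReal.toReal_pos (hx' i hi) (measure_ne_top _ _)) ?_
        exact ENNReal.toReal_mono (measure_ne_top _ _)
          ((Measure.restrict_apply_le _ _).trans (measure_mono hsub))


/-- Jensen-type lower bound for the entropy integral: for `A ⊆ K`, `μ ∈ P(K)` and `r > 0`,
`∫_A log μ(B(x,2r)) dμ(x) ≥ -μ(A(r)) log N_r(A) - e⁻¹`. -/
theorem entropy_integral_lower_bound (d : ℕ) (K : Set (Euc d)) (hK : IsCompact K)
    (A : Set ↥K) (μ : ProbabilityMeasure ↥K) (r : ℝ) (hr : 0 < r) :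
    -((μ : Measure ↥K) (Metric.thickening r A)).toReal * Real.log (coveringNumber A r : ℝ)
        - Real.exp (-1)
      ≤ ∫ x in A, Real.log (((μ : Measure ↥K) (ball x (2*r))).toReal)
          ∂(μ : Measure ↥K) := by
  have : CompactSpace ↥K := isCompact_iff_compactSpace.1 hK
  obtain ⟨c, hc⟩ := exists_cover_coveringNumber A hr
  rcases Nat.eq_zero_or_pos (coveringNumber A r) with hN | hN
  · have : IsEmpty (Fin (coveringNumber A r)) := by rw [hN]; infer_instance
    have hA : A = ∅ := by simpa using hc
    rw [hN, hA]
    simp [Real.exp_nonneg]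
  · refine le_trans ?_ (entropy_integral_ge_of_cover (μ : Measure ↥K) hN c hc)
    have hmono : (μ : Measure ↥K).real A ≤ (μ : Measure ↥K).real (thickening r A) :=
      measureReal_mono (self_subset_thickening hr A)
    have := mul_le_mul_of_nonneg_right hmono (Real.log_natCast_nonneg (coveringNumber A r))
    simp only [Measure.real] at this ⊢
    linarith

end
end
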